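/- arXiv:1406.6803 — 8 statements merged into one kernel-verified Lean document; each statement's English description precedes it below -/
import Mathlib

section
/- For every natural number n, the group with presentation G(P_n) = ⟨x, y | xyx = yxy, x^{n+1} = y^n⟩ is the trivial group. Formally, the presented group on two generators x, y with the two relators (xyx)(yxy)^{-1} and x^{n+1}y^{-n} is a subsingleton (every element equals the identity). -/
/-- The relators of the presentation G(P_n) = ⟨x, y | xyx = yxy, x^{n+1} = y^n⟩,
as elements of the free group on two generators `x = FreeGroup.of 0`,
`y = FreeGroup.of 1`. -/
def GPnRels (n : ℕ) : Set (FreeGroup (Fin 2)) :=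
  { (FreeGroup.of 0 * FreeGroup.of 1 * FreeGroup.of 0) *
      (FreeGroup.of 1 * FreeGroup.of 0 * FreeGroup.of 1)⁻¹,
    (FreeGroup.of 0) ^ (n + 1) * ((FreeGroup.of 1) ^ n)⁻¹ }

/-- A group whose elements `x`, `y` satisfy the braid relation and `x ^ (n + 1) = y ^ n`
has `x = 1` and `y = 1`. -/
theorem eq_one_of_braid_of_pow_succ_eq_pow {G : Type*} [Group G] {x y : G} {n : ℕ}
    (hb : x * y * x = y * x * y) (hp : x ^ (n + 1) = y ^ n) : x = 1 ∧ y = 1 := by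
  have hconj : SemiconjBy (x * y) x y := by
    rw [SemiconjBy, hb, mul_assoc]
  have hcomm : SemiconjBy (x * y) (x ^ (n + 1)) (x ^ (n + 1)) := by
    refine SemiconjBy.mul_left ((Commute.refl x).pow_right (n + 1)) ?_
    rw [hp]
    exact (Commute.refl y).pow_right n
  have hpow : x ^ (n + 1) = y ^ (n + 1) :=
    mul_right_cancel (hcomm.eq.symm.trans (hconj.pow_right (n + 1)).eq)
  have hy : y = 1 := by
    rw [hp, pow_succ] at hpow
    exact left_eq_mul.mp hpow
  subst hy
  refine ⟨?_, rfl⟩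
  simpa using hb

theorem GPn_trivial (n : ℕ) : Subsingleton (PresentedGroup (GPnRels n)) := by
  obtain ⟨hx, hy⟩ := eq_one_of_braid_of_pow_succ_eq_pow (n := n)
    (x := (PresentedGroup.of 0 : PresentedGroup (GPnRels n)))
    (y := (PresentedGroup.of 1 : PresentedGroup (GPnRels n)))
    (PresentedGroup.mk_eq_mk_of_mul_inv_mem (Set.mem_insert _ _))
    (PresentedGroup.mk_eq_mk_of_mul_inv_mem
      (Set.mem_insert_of_mem _ (Set.mem_singleton _)))
  have hid : MonoidHom.id (PresentedGroup (GPnRels n)) = 1 := by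
    refine PresentedGroup.ext fun i => ?_
    fin_cases i
    · exact hx
    · exact hy
  refine ⟨fun a b => ?_⟩
  exact (DFunLike.congr_fun hid a).trans (DFunLike.congr_fun hid b).symm
end

section
/- Let G be a group, x, y ∈ G, and n a natural number. If xyx = yxy and x^{n+1} = y^n, then y^{n+1} = y^n. -/
theorem pow_succ_eq_pow {G : Type*} [Group G] (x y : G) (n : ℕ)
    (h1 : x * y * x = y * x * y) (h2 : x ^ (n + 1) = y ^ n) :
    y ^ (n + 1) = y ^ n := by
  have h : SemiconjBy (y * x) y x := by
    rw [SemiconjBy, ← h1, mul_assoc]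
  have hx : Commute x (y ^ n) := h2 ▸ Commute.self_pow x (n + 1)
  have hy : Commute y (y ^ n) := Commute.self_pow y n
  apply mul_left_cancel (a := y * x)
  rw [(h.pow_right (n + 1)).eq, h2]
  exact (hy.mul_left hx).eq.symm
end

section
/- Let G be a group, x, y ∈ G, and n a natural number. If xyx = yxy and x^{n+1} = y^n, then x = 1 and y = 1. -/
theorem trivial_of_relations {G : Type*} [Group G] (x y : G) (n : ℕ)
    (h1 : x * y * x = y * x * y) (h2 : x ^ (n + 1) = y ^ n) :
    x = 1 ∧ y = 1 := by
  -- Conjugation by `x * y * x` swaps `x` and `y`, so it swaps their roles in `h2` too.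
  have hx : SemiconjBy (x * y * x) x y :=
    (congrArg (· * x) h1).trans (by simp only [mul_assoc])
  have hy : SemiconjBy (x * y * x) y x := by
    rw [SemiconjBy, mul_assoc, mul_assoc, mul_assoc, ← mul_assoc y, ← h1, mul_assoc]
  have h3 : y ^ (n + 1) = x ^ n := by
    have h := hx.pow_right (n + 1)
    rw [h2] at h
    exact mul_right_cancel (h.eq.symm.trans (hy.pow_right n).eq)
  have hn : Commute (x ^ n) y := h3 ▸ (Commute.refl y).pow_left (n + 1)
  have hs : Commute (x ^ (n + 1)) y := h2 ▸ (Commute.refl y).pow_left n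
  have hc : Commute x y := by
    have h := hn.inv_left.mul_left hs
    rwa [pow_succ, inv_mul_cancel_left] at h
  have hxy : x = y := by
    rw [← hc.eq] at h1
    exact mul_left_cancel h1
  subst hxy
  have hone : x = 1 := by rwa [pow_succ, mul_eq_left] at h2
  exact ⟨hone, hone⟩
end

section
/- Let G be a group and x, y ∈ G. If x^2 y x^{-1} y x^{-1} y^{-1} = 1 and y^{-2} x^{-1} y x^{-1} y x = 1, then xyx = yxy. -/
theorem braid_of_rels {G : Type*} [Group G] (x y : G)
    (ha : x ^ 2 * y * x⁻¹ * y * x⁻¹ * y⁻¹ = 1)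
    (hb : y⁻¹ ^ 2 * x⁻¹ * y * x⁻¹ * y * x = 1) :
    x * y * x = y * x * y := by
  have h₁ : x⁻¹ * y * x * y⁻¹ = x * y * x⁻¹ := by
    calc x⁻¹ * y * x * y⁻¹
        = x⁻¹ * (x ^ 2 * y * x⁻¹ * y * x⁻¹ * y⁻¹) * y * x * y⁻¹ := by rw [ha, mul_one]
      _ = x * y * x⁻¹ := by group
  have h₂ : x⁻¹ * y * x * y⁻¹ = y⁻¹ * x * y := by
    calc x⁻¹ * y * x * y⁻¹
        = y⁻¹ * x * y ^ 2 * (y⁻¹ ^ 2 * x⁻¹ * y * x⁻¹ * y * x) * y⁻¹ := by group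
      _ = y⁻¹ * x * y := by rw [hb]; group
  calc x * y * x = y * (y⁻¹ * x * y) * x := by group
    _ = y * (x * y * x⁻¹) * x := by rw [← h₂, h₁]
    _ = y * x * y := by group
end

section
/- Let G be a group and x, y ∈ G. If x^2 y x^{-1} y x^{-1} y^{-1} = 1 and y^{-2} x^{-1} y x^{-1} y x = 1, then x^3 y = y x^2. -/
theorem x3y_eq_yx2 {G : Type*} [Group G] (x y : G)
    (ha : x ^ 2 * y * x⁻¹ * y * x⁻¹ * y⁻¹ = 1)
    (hb : y⁻¹ ^ 2 * x⁻¹ * y * x⁻¹ * y * x = 1) :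
    x ^ 3 * y = y * x ^ 2 := by
  obtain ⟨z, rfl⟩ : ∃ z, y = x * z := ⟨x⁻¹ * y, by group⟩
  have hzx : z * x = x ^ 2 * z ^ 2 := by
    have h := mul_inv_eq_one.mp ha
    calc z * x = x⁻¹ * (x * z) * x := by group
      _ = x⁻¹ * (x ^ 2 * (x * z) * x⁻¹ * (x * z) * x⁻¹) * x := by rw [h]
      _ = x ^ 2 * z ^ 2 := by simp [pow_succ, mul_assoc]
  have hzzx : z ^ 2 * x = x * z * x * z := by
    calc z ^ 2 * x
        = (x * z) ^ 2 * ((x * z)⁻¹ ^ 2 * x⁻¹ * (x * z) * x⁻¹ * (x * z) * x) := by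
          simp [pow_succ, mul_assoc]
      _ = x * z * x * z := by rw [hb]; simp [pow_succ, mul_assoc]
  have h₁ : z * x ^ 2 = x ^ 5 * z ^ 3 := by
    calc z * x ^ 2 = (z * x) * x := by simp [pow_succ, mul_assoc]
      _ = x ^ 2 * (z ^ 2 * x) := by rw [hzx, mul_assoc]
      _ = x ^ 3 * (z * x) * z := by rw [hzzx]; simp [pow_succ, mul_assoc]
      _ = x ^ 5 * z ^ 3 := by rw [hzx]; simp [pow_succ, mul_assoc]
  have h₂ : z * x ^ 2 = x ^ 2 * (z * x ^ 2) * z ^ 2 := by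
    calc z * x ^ 2 = (z * x) * x := by simp [pow_succ, mul_assoc]
      _ = x ^ 2 * z ^ 2 * x := by rw [hzx]
      _ = x ^ 2 * z * (z * x) := by simp [pow_succ, mul_assoc]
      _ = x ^ 2 * (z * x ^ 2) * z ^ 2 := by rw [hzx]; simp [mul_assoc]
  have h₃ : z * x ^ 2 = x ^ 3 * z := by
    calc z * x ^ 2 = x⁻¹ ^ 2 * (x ^ 2 * (z * x ^ 2) * z ^ 2) * z⁻¹ ^ 2 := by
          simp [pow_succ, mul_assoc]
      _ = x⁻¹ ^ 2 * (x ^ 5 * z ^ 3) * z⁻¹ ^ 2 := by rw [← h₂, h₁]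
      _ = x ^ 3 * z := by simp [pow_succ, mul_assoc]
  calc x ^ 3 * (x * z) = x * (x ^ 3 * z) := by simp [pow_succ, mul_assoc]
    _ = x * z * x ^ 2 := by rw [← h₃, mul_assoc]
end

section
/- Let G be a group and x, y ∈ G. If x^2 y x^{-1} y x^{-1} y^{-1} = 1 and y^{-2} x^{-1} y x^{-1} y x = 1, then x^3 = y^2. -/
theorem x3_eq_y2 {G : Type*} [Group G] (x y : G)
    (ha : x ^ 2 * y * x⁻¹ * y * x⁻¹ * y⁻¹ = 1)
    (hb : y⁻¹ ^ 2 * x⁻¹ * y * x⁻¹ * y * x = 1) :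
    x ^ 3 = y ^ 2 := by
  have hyx : y * x⁻¹ * y = x⁻¹ ^ 2 * y * x := by
    calc y * x⁻¹ * y
        = x⁻¹ ^ 2 * (x ^ 2 * y * x⁻¹ * y * x⁻¹ * y⁻¹) * y * x := by group
      _ = x⁻¹ ^ 2 * y * x := by rw [ha, mul_one]
  have hxy : y * x⁻¹ * y = x * y ^ 2 * x⁻¹ := by
    calc y * x⁻¹ * y
        = x * y ^ 2 * (y⁻¹ ^ 2 * x⁻¹ * y * x⁻¹ * y * x) * x⁻¹ := by group
      _ = x * y ^ 2 * x⁻¹ := by rw [hb, mul_one]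
  have h₁ : y * x ^ 2 = x ^ 3 * y ^ 2 := by
    calc y * x ^ 2 = x ^ 2 * (x⁻¹ ^ 2 * y * x) * x := by simp [sq, mul_assoc]
      _ = x ^ 2 * (x * y ^ 2 * x⁻¹) * x := by rw [← hyx, hxy]
      _ = x ^ 3 * y ^ 2 := by group
  have h₂ : x ^ 2 * y ^ 3 = y ^ 2 * x := by
    calc x ^ 2 * y ^ 3 = x ^ 2 * y * (x⁻¹ * (x * y ^ 2 * x⁻¹)) * x := by group
      _ = x ^ 2 * y * (x⁻¹ * (y * x⁻¹ * y)) * x := by rw [hxy]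
      _ = x ^ 2 * (y * x⁻¹ * y) * x⁻¹ * y * x := by group
      _ = y ^ 2 * x := by rw [hyx]; simp [sq, mul_assoc]
  have h₃ : y * x ^ 2 * y = x * y ^ 2 * x := by
    calc y * x ^ 2 * y = x * (x ^ 2 * y ^ 3) := by rw [h₁]; group
      _ = x * y ^ 2 * x := by rw [h₂, mul_assoc]
  have h₄ : y * x ^ 2 = x ^ 3 * y := by
    calc y * x ^ 2 = x * y⁻¹ * (y * x⁻¹ * y) * x ^ 2 := by group
      _ = x * y⁻¹ * (x * y ^ 2 * x) := by rw [hxy]; group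
      _ = x ^ 3 * y := by rw [← h₃]; group
  have hy : y = 1 := by
    have h : x ^ 3 * y * y = x ^ 3 * y := by
      rw [mul_assoc, ← sq, ← h₁, h₄]
    exact mul_eq_left.mp h
  have hx : x = 1 := by simpa [hy] using hb
  simp [hx, hy]
end

section
/- Let G be a group and x, y ∈ G. If x^2 y x^{-1} y x^{-1} y^{-1} = 1 and y^{-2} x^{-1} y x^{-1} y x = 1, then x = 1 and y = 1. -/
theorem eq_one_of_twin_rels_aux {G : Type*} [Group G] {x w : G}
    (h : x ^ 2 * w ^ 2 = w * x) (h' : x ^ 5 * w ^ 3 = w * x ^ 2) : x = 1 ∧ w = 1 := by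
  have h₁ : w ^ 2 * x = x ^ 5 * w ^ 5 := by
    calc w ^ 2 * x = w * (w * x) := by rw [pow_two, mul_assoc]
      _ = w * x ^ 2 * w ^ 2 := by rw [← h]; group
      _ = x ^ 5 * w ^ 5 := by rw [← h']; group
  have h₂ : x ^ 5 * w ^ 3 = x ^ 5 * (x ^ 2 * w ^ 2) * w ^ 3 := by
    calc x ^ 5 * w ^ 3 = w * x * x := by rw [h', pow_two, mul_assoc]
      _ = x ^ 2 * (w ^ 2 * x) := by rw [← h]; group
      _ = x ^ 5 * (x ^ 2 * w ^ 2) * w ^ 3 := by rw [h₁]; group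
  have h₃ : w * x = 1 := by
    rw [← h]
    exact mul_eq_left.mp (mul_right_cancel h₂).symm
  obtain rfl : w = x⁻¹ := eq_inv_of_mul_eq_one_left h₃
  have hx : x = 1 := by
    calc x = x⁻¹ * (x ^ 5 * x⁻¹ ^ 3) := by group
      _ = 1 := by rw [h']; group
  simp [hx]

theorem trivial_of_twin_rels {G : Type*} [Group G] (x y : G)
    (ha : x ^ 2 * y * x⁻¹ * y * x⁻¹ * y⁻¹ = 1)
    (hb : y⁻¹ ^ 2 * x⁻¹ * y * x⁻¹ * y * x = 1) :
    x = 1 ∧ y = 1 := by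
  obtain ⟨w, hw⟩ : ∃ w, w = y * x⁻¹ * y := ⟨_, rfl⟩
  have hy : y = x ^ 2 * w * x⁻¹ := by
    calc y = 1 * y := (one_mul y).symm
      _ = x ^ 2 * w * x⁻¹ := by rw [← ha, hw]; group
  have hwx : w * x = x * y ^ 2 := by
    calc w * x = x * y ^ 2 * (y⁻¹ ^ 2 * x⁻¹ * y * x⁻¹ * y * x) := by rw [hw]; group
      _ = x * y ^ 2 := by rw [hb, mul_one]
  have h : x ^ 2 * w ^ 2 = w * x := by
    rw [hy] at hw
    calc x ^ 2 * w ^ 2 = (x ^ 2 * w * x⁻¹ * x⁻¹ * (x ^ 2 * w * x⁻¹)) * x := by rw [pow_two w]; group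
      _ = w * x := by rw [← hw]
  have h' : x ^ 5 * w ^ 3 = w * x ^ 2 := by
    rw [hy] at hwx
    calc x ^ 5 * w ^ 3 = x ^ 3 * (x ^ 2 * w ^ 2) * w := by group
      _ = x * (x ^ 2 * w * x⁻¹) ^ 2 * x := by rw [h, pow_two (x ^ 2 * w * x⁻¹)]; group
      _ = w * x ^ 2 := by rw [← hwx, pow_two, mul_assoc]
  obtain ⟨rfl, rfl⟩ := eq_one_of_twin_rels_aux h h'
  simpa using hy
end

section
/- The presented group on two generators x, y with the two relators x^2 y x^{-1} y x^{-1} y^{-1} and y^{-2} x^{-1} y x^{-1} y x is the trivial group, i.e. this presented group is a subsingleton. -/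
/-- The relators x^2 y x^{-1} y x^{-1} y^{-1} and y^{-2} x^{-1} y x^{-1} y x
of the fundamental group presentation of the twin handlebody W_0^*,
as elements of the free group on two generators `x = FreeGroup.of 0`,
`y = FreeGroup.of 1`. -/
def twinRels : Set (FreeGroup (Fin 2)) :=
  { (FreeGroup.of 0) ^ 2 * FreeGroup.of 1 * (FreeGroup.of 0)⁻¹ *
      FreeGroup.of 1 * (FreeGroup.of 0)⁻¹ * (FreeGroup.of 1)⁻¹,
    ((FreeGroup.of 1)⁻¹) ^ 2 * (FreeGroup.of 0)⁻¹ * FreeGroup.of 1 *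
      (FreeGroup.of 0)⁻¹ * FreeGroup.of 1 * FreeGroup.of 0 }

/-- A pair of group elements satisfying the two relators of `twinRels` is trivial. -/
theorem eq_one_of_twin_relations {G : Type*} [Group G] {x y : G}
    (h₁ : x ^ 2 * y * x⁻¹ * y * x⁻¹ * y⁻¹ = 1)
    (h₂ : y⁻¹ ^ 2 * x⁻¹ * y * x⁻¹ * y * x = 1) : x = 1 ∧ y = 1 := by
  have braid : y⁻¹ * x * y * x * y⁻¹ * x⁻¹ = 1 := by
    have key : y⁻¹ * x * y * x * y⁻¹ * x⁻¹ =
        (x⁻¹ * y * x) * (y⁻¹ ^ 2 * x⁻¹ * y * x⁻¹ * y * x)⁻¹ *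
          ((x⁻¹ * y⁻¹) * (x ^ 2 * y * x⁻¹ * y * x⁻¹ * y⁻¹)⁻¹ * (y * x)) * (x⁻¹ * y⁻¹ * x) := by
      group
    rw [key, h₁, h₂]
    group
  have hc : x ^ 2 * y * x⁻¹ * x⁻¹ * y⁻¹ * x = 1 := by
    have key : x ^ 2 * y * x⁻¹ * x⁻¹ * y⁻¹ * x =
        (x ^ 2 * y * x⁻¹ * y * x⁻¹ * y⁻¹) *
          ((x⁻¹ * y) * (y⁻¹ * x * y * x * y⁻¹ * x⁻¹) * (y⁻¹ * x)) := by
      group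
    rw [key, h₁, braid]
    group
  have hd : x * y⁻¹ * x⁻¹ * y * x⁻¹ * y = 1 := by
    have key : x * y⁻¹ * x⁻¹ * y * x⁻¹ * y =
        (x⁻¹ * y⁻¹ * x) * (x ^ 2 * y * x⁻¹ * x⁻¹ * y⁻¹ * x)⁻¹ *
          (x⁻¹ * (x ^ 2 * y * x⁻¹ * y * x⁻¹ * y⁻¹) * x) * (x⁻¹ * y * x) := by
      group
    rw [key, h₁, hc]
    group
  have hy : y = 1 := by
    have key : y = ((x⁻¹ * y * x⁻¹ * y * x) * (x⁻¹ * (x * y⁻¹ * x⁻¹ * y * x⁻¹ * y)⁻¹ * x) *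
        (y⁻¹ ^ 2 * x⁻¹ * y * x⁻¹ * y * x) * (x⁻¹ * y⁻¹ * x * y⁻¹ * x))⁻¹ := by
      group
    rw [key, hd, h₂]
    group
  subst hy
  exact ⟨by simpa using h₂, rfl⟩

theorem twin_presentation_trivial : Subsingleton (PresentedGroup twinRels) := by
  have h₁ := PresentedGroup.one_of_mem (rels := twinRels) (Or.inl rfl)
  have h₂ := PresentedGroup.one_of_mem (rels := twinRels) (Or.inr rfl)
  simp only [map_mul, map_pow, map_inv] at h₁ h₂
  obtain ⟨hx, hy⟩ := eq_one_of_twin_relations h₁ h₂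
  have h : MonoidHom.id (PresentedGroup twinRels) = 1 := by
    ext i
    fin_cases i
    · exact hx
    · exact hy
  exact subsingleton_of_forall_eq 1 fun g => DFunLike.congr_fun h g
end
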